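/- Let K_ℝ be the field of rational functions over ℝ in the 15 coordinates of a triple (u₁, u₂, C) of two vectors u₁, u₂ ∈ ℝ³ and a real 3×3 matrix C, equipped with the action of G_ℝ = SO₃(ℝ)×SO₃(ℝ) by field automorphisms induced by precomposition with the linear action (u₁,u₂,C) ↦ (g₁u₁, g₂u₂, g₁Cg₂ᵀ). Then the fixed field K_ℝ^{G_ℝ} is purely transcendental over ℝ, equal to the subfield ℝ(f₁, …, f₉) generated by the nine invariants f₁, …, f₉, which are algebraically independent over ℝ. (The field of real-valued rational local unitary invariants of mixed states of two qubits is rational of degree 9.) -/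

import Mathlib

open Matrix MvPolynomial

/-- `SO₃(ℝ)`: real 3×3 matrices with `gᵀ g = 1` and `det g = 1`. -/
def SO3R (g : Matrix (Fin 3) (Fin 3) ℝ) : Prop := gᵀ * g = 1 ∧ g.det = 1

/-- The generic vector `u₁` with real polynomial entries. -/
noncomputable def genU₁R : Fin 3 → MvPolynomial (Fin 15) ℝ := ![X 0, X 1, X 2]

/-- The generic vector `u₂` with real polynomial entries. -/
noncomputable def genU₂R : Fin 3 → MvPolynomial (Fin 15) ℝ := ![X 3, X 4, X 5]

/-- The generic real 3×3 matrix `C = (cᵢⱼ)` with polynomial entries. -/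
noncomputable def genCR : Matrix (Fin 3) (Fin 3) (MvPolynomial (Fin 15) ℝ) :=
  !![X 6, X 7, X 8; X 9, X 10, X 11; X 12, X 13, X 14]

/-- The nine invariants `f₁, …, f₉` as real polynomials in the 15 coordinates of
`(u₁, u₂, C)`, where `v₁ = u₁ × (Cu₂)`, `v₂ = u₂ × (Cᵀu₁)`, `w₁ = u₁ × v₁`,
`w₂ = u₂ × v₂`. -/
noncomputable def genFpolyR : Fin 9 → MvPolynomial (Fin 15) ℝ :=
  let u₁ := genU₁R
  let u₂ := genU₂R
  let C := genCR
  let v₁ := crossProduct u₁ (C *ᵥ u₂)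
  let v₂ := crossProduct u₂ (Cᵀ *ᵥ u₁)
  let w₁ := crossProduct u₁ v₁
  let w₂ := crossProduct u₂ v₂
  ![u₁ ⬝ᵥ u₁, u₂ ⬝ᵥ u₂, v₁ ⬝ᵥ v₁, v₂ ⬝ᵥ v₂, u₁ ⬝ᵥ (C *ᵥ u₂),
    v₁ ⬝ᵥ (C *ᵥ v₂), w₁ ⬝ᵥ (C *ᵥ w₂), v₁ ⬝ᵥ (C *ᵥ w₂), w₁ ⬝ᵥ (C *ᵥ v₂)]

/-- The SO₃(ℝ)×SO₃(ℝ)-action on the 15 coordinates of a real triple `(u₁, u₂, C)`,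
given by `(u₁, u₂, C) ↦ (g₁u₁, g₂u₂, g₁Cg₂ᵀ)`. -/
noncomputable def genActR (g₁ g₂ : Matrix (Fin 3) (Fin 3) ℝ) (x : Fin 15 → ℝ) :
    Fin 15 → ℝ :=
  let u₁ : Fin 3 → ℝ := ![x 0, x 1, x 2]
  let u₂ : Fin 3 → ℝ := ![x 3, x 4, x 5]
  let C : Matrix (Fin 3) (Fin 3) ℝ :=
    !![x 6, x 7, x 8; x 9, x 10, x 11; x 12, x 13, x 14]
  let u₁' := g₁ *ᵥ u₁
  let u₂' := g₂ *ᵥ u₂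
  let C' := g₁ * C * g₂ᵀ
  ![u₁' 0, u₁' 1, u₁' 2, u₂' 0, u₂' 1, u₂' 2,
    C' 0 0, C' 0 1, C' 0 2, C' 1 0, C' 1 1, C' 1 2, C' 2 0, C' 2 1, C' 2 2]

/-- The nine invariants of a triple `(u₁, u₂, C)` over an arbitrary commutative ring. -/
def tripleInvariants {R : Type*} [CommRing R] (u₁ u₂ : Fin 3 → R)
    (C : Matrix (Fin 3) (Fin 3) R) : Fin 9 → R :=
  let v₁ := crossProduct u₁ (C *ᵥ u₂)
  let v₂ := crossProduct u₂ (Cᵀ *ᵥ u₁)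
  let w₁ := crossProduct u₁ v₁
  let w₂ := crossProduct u₂ v₂
  ![u₁ ⬝ᵥ u₁, u₂ ⬝ᵥ u₂, v₁ ⬝ᵥ v₁, v₂ ⬝ᵥ v₂, u₁ ⬝ᵥ (C *ᵥ u₂),
    v₁ ⬝ᵥ (C *ᵥ v₂), w₁ ⬝ᵥ (C *ᵥ w₂), v₁ ⬝ᵥ (C *ᵥ w₂), w₁ ⬝ᵥ (C *ᵥ v₂)]

/-- The 15 coordinates of a triple. -/
def tripleCoords {R : Type*} (u₁ u₂ : Fin 3 → R) (C : Matrix (Fin 3) (Fin 3) R) : Fin 15 → R :=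
  ![u₁ 0, u₁ 1, u₁ 2, u₂ 0, u₂ 1, u₂ 2,
    C 0 0, C 0 1, C 0 2, C 1 0, C 1 1, C 1 2, C 2 0, C 2 1, C 2 2]

/-- The first vector of the triple with given coordinates. -/
def coordFst {R : Type*} (x : Fin 15 → R) : Fin 3 → R := ![x 0, x 1, x 2]

/-- The second vector of the triple with given coordinates. -/
def coordSnd {R : Type*} (x : Fin 15 → R) : Fin 3 → R := ![x 3, x 4, x 5]

/-- The matrix of the triple with given coordinates. -/
def coordMatrix {R : Type*} (x : Fin 15 → R) : Matrix (Fin 3) (Fin 3) R :=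
  !![x 6, x 7, x 8; x 9, x 10, x 11; x 12, x 13, x 14]

/-- The nine invariants in terms of the 15 coordinates of a triple. -/
def coordInvariants {R : Type*} [CommRing R] (x : Fin 15 → R) : Fin 9 → R :=
  tripleInvariants (coordFst x) (coordSnd x) (coordMatrix x)

/-- The action of a pair of matrices on the 15 coordinates of a triple. -/
def coordAct {R : Type*} [CommRing R] (g₁ g₂ : Matrix (Fin 3) (Fin 3) R) (x : Fin 15 → R) :
    Fin 15 → R :=
  tripleCoords (g₁ *ᵥ coordFst x) (g₂ *ᵥ coordSnd x) (g₁ * coordMatrix x * g₂ᵀ)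

/-- Triples in normal form: `u₁`, `u₂` on the first axis, `C₁₂ = C₂₁ = 0`. -/
def slice {R : Type*} [CommRing R] (s : Fin 9 → R) : Fin 15 → R :=
  tripleCoords ![s 0, 0, 0] ![s 1, 0, 0] !![s 2, 0, s 3; 0, s 5, s 6; s 4, s 7, s 8]

theorem genActR_eq_coordAct (g₁ g₂ : Matrix (Fin 3) (Fin 3) ℝ) (x : Fin 15 → ℝ) :
    genActR g₁ g₂ x = coordAct g₁ g₂ x := rfl

theorem genFpolyR_eq_coordInvariants : genFpolyR = coordInvariants X := rfl

section Coordinates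

variable {R S : Type*}

theorem eta_vec (u : Fin 3 → R) : ![u 0, u 1, u 2] = u := by
  funext i; fin_cases i <;> rfl

theorem coordFst_tripleCoords (u₁ u₂ : Fin 3 → R) (C : Matrix (Fin 3) (Fin 3) R) :
    coordFst (tripleCoords u₁ u₂ C) = u₁ := eta_vec u₁

theorem coordSnd_tripleCoords (u₁ u₂ : Fin 3 → R) (C : Matrix (Fin 3) (Fin 3) R) :
    coordSnd (tripleCoords u₁ u₂ C) = u₂ := eta_vec u₂

theorem coordMatrix_tripleCoords (u₁ u₂ : Fin 3 → R) (C : Matrix (Fin 3) (Fin 3) R) :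
    coordMatrix (tripleCoords u₁ u₂ C) = C := (eta_fin_three C).symm

theorem tripleCoords_coord (x : Fin 15 → R) :
    tripleCoords (coordFst x) (coordSnd x) (coordMatrix x) = x := by
  funext i; fin_cases i <;> rfl

theorem comp_tripleCoords (f : R → S) (u₁ u₂ : Fin 3 → R) (C : Matrix (Fin 3) (Fin 3) R) :
    f ∘ tripleCoords u₁ u₂ C = tripleCoords (f ∘ u₁) (f ∘ u₂) (C.map f) := by
  funext i; fin_cases i <;> rfl

theorem coordFst_comp (f : R → S) (x : Fin 15 → R) : coordFst (f ∘ x) = f ∘ coordFst x := by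
  funext i; fin_cases i <;> rfl

theorem coordSnd_comp (f : R → S) (x : Fin 15 → R) : coordSnd (f ∘ x) = f ∘ coordSnd x := by
  funext i; fin_cases i <;> rfl

theorem coordMatrix_comp (f : R → S) (x : Fin 15 → R) :
    coordMatrix (f ∘ x) = (coordMatrix x).map f := by
  ext i j; fin_cases i <;> fin_cases j <;> rfl

variable [CommRing R] [CommRing S]

theorem comp_mulVec (f : R →+* S) (M : Matrix (Fin 3) (Fin 3) R) (v : Fin 3 → R) :
    f ∘ (M *ᵥ v) = M.map f *ᵥ (f ∘ v) :=
  funext fun i => RingHom.map_mulVec f M v i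

theorem comp_cross (f : R →+* S) (u v : Fin 3 → R) :
    f ∘ crossProduct u v = crossProduct (f ∘ u) (f ∘ v) := by
  funext i; fin_cases i <;> simp [cross_apply]

theorem comp_tripleInvariants (f : R →+* S) (u₁ u₂ : Fin 3 → R) (C : Matrix (Fin 3) (Fin 3) R) :
    f ∘ tripleInvariants u₁ u₂ C = tripleInvariants (f ∘ u₁) (f ∘ u₂) (C.map f) := by
  have ht : (C.map f)ᵀ = Cᵀ.map f := rfl
  simp only [tripleInvariants, ht, ← comp_mulVec, ← comp_cross,
    ← RingHom.map_dotProduct]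
  funext i; fin_cases i <;> rfl

theorem comp_coordInvariants (f : R →+* S) (x : Fin 15 → R) :
    f ∘ coordInvariants x = coordInvariants (f ∘ x) := by
  rw [coordInvariants, comp_tripleInvariants, coordInvariants, coordFst_comp, coordSnd_comp,
    coordMatrix_comp]

theorem comp_coordAct (f : R →+* S) (g₁ g₂ : Matrix (Fin 3) (Fin 3) R) (x : Fin 15 → R) :
    f ∘ coordAct g₁ g₂ x = coordAct (g₁.map f) (g₂.map f) (f ∘ x) := by
  rw [coordAct, comp_tripleCoords, coordAct, coordFst_comp, coordSnd_comp, coordMatrix_comp,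
    comp_mulVec, comp_mulVec, Matrix.map_mul, Matrix.map_mul, transpose_map]

theorem comp_slice (f : R →+* S) (s : Fin 9 → R) : f ∘ slice s = slice (f ∘ s) := by
  rw [slice, comp_tripleCoords, slice]
  congr 1
  · funext i; fin_cases i <;> simp
  · funext i; fin_cases i <;> simp
  · ext i j; fin_cases i <;> fin_cases j <;> simp

theorem coordInvariants_slice (s : Fin 9 → R) :
    coordInvariants (slice s) =
      ![s 0 ^ 2, s 1 ^ 2, (s 0 * s 1 * s 4) ^ 2, (s 0 * s 1 * s 3) ^ 2, s 0 * s 1 * s 2,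
        s 0 ^ 2 * s 1 ^ 2 * s 3 * s 4 * s 5, s 0 ^ 3 * s 1 ^ 3 * s 3 * s 4 * s 8,
        s 0 ^ 2 * s 1 ^ 3 * s 3 * s 4 * s 6, s 0 ^ 3 * s 1 ^ 2 * s 3 * s 4 * s 7] := by
  rw [coordInvariants, slice, coordFst_tripleCoords, coordSnd_tripleCoords,
    coordMatrix_tripleCoords]
  generalize s 0 = a, s 1 = b, s 2 = c₁₁, s 3 = c₁₃, s 4 = c₃₁, s 5 = c₂₂, s 6 = c₂₃,
    s 7 = c₃₂, s 8 = c₃₃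
  have hmul (x y z : R) : !![c₁₁, 0, c₁₃; 0, c₂₂, c₂₃; c₃₁, c₃₂, c₃₃] *ᵥ ![x, y, z] =
      ![c₁₁ * x + c₁₃ * z, c₂₂ * y + c₂₃ * z, c₃₁ * x + c₃₂ * y + c₃₃ * z] := by
    funext i
    fin_cases i <;> simp [mulVec, dotProduct, Fin.sum_univ_three]
  have hmul' (x y z : R) : !![c₁₁, 0, c₁₃; 0, c₂₂, c₂₃; c₃₁, c₃₂, c₃₃]ᵀ *ᵥ ![x, y, z] =
      ![c₁₁ * x + c₃₁ * z, c₂₂ * y + c₃₂ * z, c₁₃ * x + c₂₃ * y + c₃₃ * z] := by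
    funext i
    fin_cases i <;> simp [mulVec, dotProduct, Fin.sum_univ_three]
  have hcross (x y z x' y' z' : R) : crossProduct ![x, y, z] ![x', y', z'] =
      ![y * z' - z * y', z * x' - x * z', x * y' - y * x'] := by
    simp [cross_apply]
  have hdot (x y z x' y' z' : R) : ![x, y, z] ⬝ᵥ ![x', y', z'] = x * x' + y * y' + z * z' :=
    vec3_dotProduct'
  simp only [tripleInvariants, hmul, hmul', hcross, hdot]
  funext i
  fin_cases i <;> dsimp <;> ring

theorem coordAct_coordAct (g₁ g₂ h₁ h₂ : Matrix (Fin 3) (Fin 3) R) (x : Fin 15 → R) :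
    coordAct g₁ g₂ (coordAct h₁ h₂ x) = coordAct (g₁ * h₁) (g₂ * h₂) x := by
  simp only [coordAct, coordFst_tripleCoords, coordSnd_tripleCoords, coordMatrix_tripleCoords,
    mulVec_mulVec, transpose_mul, Matrix.mul_assoc]

theorem coordAct_one (x : Fin 15 → R) : coordAct 1 1 x = x := by
  simp [coordAct, tripleCoords_coord]

theorem mulVec_cross_mulVec (M : Matrix (Fin 3) (Fin 3) R) (u v : Fin 3 → R) :
    crossProduct (M *ᵥ u) (M *ᵥ v) = M.adjugateᵀ *ᵥ crossProduct u v := by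
  funext i
  fin_cases i <;>
    simp [cross_apply, mulVec, dotProduct, Fin.sum_univ_three, adjugate_fin_three] <;> ring

end Coordinates

theorem eval_aeval {σ τ R : Type*} [CommSemiring R] (y : τ → R) (f : σ → MvPolynomial τ R)
    (p : MvPolynomial σ R) : eval y (aeval f p) = eval (eval y ∘ f) p := by
  induction p using MvPolynomial.induction_on with
  | C a => simp
  | add p q hp hq => rw [map_add, map_add, map_add, hp, hq]
  | mul_X p i hp => rw [map_mul, map_mul, map_mul, hp, aeval_X, eval_X, Function.comp_apply]

theorem eval_comp_genFpolyR (x : Fin 15 → ℝ) : eval x ∘ genFpolyR = coordInvariants x := by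
  rw [genFpolyR_eq_coordInvariants, comp_coordInvariants]
  congr 1
  funext i
  simp

theorem eval_aeval_genFpolyR (x : Fin 15 → ℝ) (P : MvPolynomial (Fin 9) ℝ) :
    eval x (aeval genFpolyR P) = eval (coordInvariants x) P := by
  rw [eval_aeval, eval_comp_genFpolyR]

/-- Precomposition of polynomials with the action of a pair of matrices. -/
noncomputable def actHom (g₁ g₂ : Matrix (Fin 3) (Fin 3) ℝ) :
    MvPolynomial (Fin 15) ℝ →ₐ[ℝ] MvPolynomial (Fin 15) ℝ :=
  aeval (coordAct (g₁.map C) (g₂.map C) X)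

theorem eval_actHom (g₁ g₂ : Matrix (Fin 3) (Fin 3) ℝ) (x : Fin 15 → ℝ)
    (p : MvPolynomial (Fin 15) ℝ) :
    eval x (actHom g₁ g₂ p) = eval (coordAct g₁ g₂ x) p := by
  rw [actHom, eval_aeval, comp_coordAct]
  congr 3
  · ext; simp
  · ext; simp
  · funext i; simp

/-! ### The group `SO₃(ℝ)` -/

theorem SO3R.mul_transpose {g : Matrix (Fin 3) (Fin 3) ℝ} (hg : SO3R g) : g * gᵀ = 1 :=
  mul_eq_one_comm.mp hg.1

theorem SO3R.transpose {g : Matrix (Fin 3) (Fin 3) ℝ} (hg : SO3R g) : SO3R gᵀ :=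
  ⟨by simpa using hg.mul_transpose, by simpa using hg.2⟩

theorem SO3R.mul {g h : Matrix (Fin 3) (Fin 3) ℝ} (hg : SO3R g) (hh : SO3R h) :
    SO3R (g * h) := by
  refine ⟨?_, by rw [det_mul, hg.2, hh.2, one_mul]⟩
  rw [transpose_mul, Matrix.mul_assoc, ← Matrix.mul_assoc gᵀ, hg.1, Matrix.one_mul, hh.1]

theorem SO3R.one : SO3R 1 := ⟨by simp, by simp⟩

theorem SO3R.adjugate {g : Matrix (Fin 3) (Fin 3) ℝ} (hg : SO3R g) : g.adjugate = gᵀ := by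
  calc g.adjugate = g.adjugate * (g * gᵀ) := by rw [hg.mul_transpose, Matrix.mul_one]
    _ = gᵀ := by rw [← Matrix.mul_assoc, adjugate_mul, hg.2, one_smul, Matrix.one_mul]

theorem SO3R.mulVec_cross {g : Matrix (Fin 3) (Fin 3) ℝ} (hg : SO3R g) (u v : Fin 3 → ℝ) :
    crossProduct (g *ᵥ u) (g *ᵥ v) = g *ᵥ crossProduct u v := by
  rw [mulVec_cross_mulVec, hg.adjugate, transpose_transpose]

theorem SO3R.mulVec_dotProduct {g : Matrix (Fin 3) (Fin 3) ℝ} (hg : SO3R g)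
    (u v : Fin 3 → ℝ) : (g *ᵥ u) ⬝ᵥ (g *ᵥ v) = u ⬝ᵥ v := by
  rw [dotProduct_mulVec, vecMul_mulVec, hg.1, vecMul_one]

theorem tripleInvariants_act {g₁ g₂ : Matrix (Fin 3) (Fin 3) ℝ} (h₁ : SO3R g₁) (h₂ : SO3R g₂)
    (u₁ u₂ : Fin 3 → ℝ) (C : Matrix (Fin 3) (Fin 3) ℝ) :
    tripleInvariants (g₁ *ᵥ u₁) (g₂ *ᵥ u₂) (g₁ * C * g₂ᵀ) = tripleInvariants u₁ u₂ C := by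
  have hC (z : Fin 3 → ℝ) : (g₁ * C * g₂ᵀ) *ᵥ (g₂ *ᵥ z) = g₁ *ᵥ (C *ᵥ z) := by
    rw [mulVec_mulVec, Matrix.mul_assoc, h₂.1, Matrix.mul_one, mulVec_mulVec]
  have hCt (z : Fin 3 → ℝ) : (g₁ * C * g₂ᵀ)ᵀ *ᵥ (g₁ *ᵥ z) = g₂ *ᵥ (Cᵀ *ᵥ z) := by
    rw [mulVec_mulVec, transpose_mul, transpose_mul, transpose_transpose, Matrix.mul_assoc,
      Matrix.mul_assoc, h₁.1, Matrix.mul_one, mulVec_mulVec]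
  simp only [tripleInvariants, hC, hCt, h₁.mulVec_cross, h₂.mulVec_cross,
    h₁.mulVec_dotProduct, h₂.mulVec_dotProduct]

theorem coordInvariants_coordAct {g₁ g₂ : Matrix (Fin 3) (Fin 3) ℝ} (h₁ : SO3R g₁)
    (h₂ : SO3R g₂) (x : Fin 15 → ℝ) :
    coordInvariants (coordAct g₁ g₂ x) = coordInvariants x := by
  rw [coordInvariants, coordAct, coordFst_tripleCoords, coordSnd_tripleCoords,
    coordMatrix_tripleCoords, tripleInvariants_act h₁ h₂, coordInvariants]

/-! ### Every generic orbit meets the slice -/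

theorem exists_sq_mul_eq_one {t : ℝ} (ht : 0 < t) : ∃ a : ℝ, a ^ 2 * t = 1 :=
  ⟨(√t)⁻¹, by rw [inv_pow, Real.sq_sqrt ht.le, inv_mul_cancel₀ ht.ne']⟩

/-- The rotation matrix whose first two rows are the directions of two orthogonal vectors. -/
theorem exists_SO3R_rows {u v : Fin 3 → ℝ} (hu : u ⬝ᵥ u ≠ 0) (hv : v ⬝ᵥ v ≠ 0)
    (huv : u ⬝ᵥ v = 0) :
    ∃ (g : Matrix (Fin 3) (Fin 3) ℝ) (a b : ℝ), SO3R g ∧ g.row 0 = a • u ∧ g.row 1 = b • v ∧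
      g.row 2 ⬝ᵥ u = 0 := by
  have pos {w : Fin 3 → ℝ} (hw : w ⬝ᵥ w ≠ 0) : 0 < w ⬝ᵥ w :=
    lt_of_le_of_ne (Finset.sum_nonneg fun i _ => mul_self_nonneg (w i)) hw.symm
  obtain ⟨a, ha⟩ := exists_sq_mul_eq_one (pos hu)
  obtain ⟨b, hb⟩ := exists_sq_mul_eq_one (pos hv)
  have hcc : crossProduct u v ⬝ᵥ crossProduct u v = (u ⬝ᵥ u) * (v ⬝ᵥ v) := by
    rw [cross_dot_cross, huv, zero_mul, sub_zero]
  have hvu : v ⬝ᵥ u = 0 := by rw [dotProduct_comm, huv]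
  have hcu : crossProduct u v ⬝ᵥ u = 0 := by rw [dotProduct_comm, dot_self_cross]
  have hcv : crossProduct u v ⬝ᵥ v = 0 := by rw [dotProduct_comm, dot_cross_self]
  set r : Fin 3 → Fin 3 → ℝ := ![a • u, b • v, (a * b) • crossProduct u v] with hr
  have hab : (a * b) * ((a * b) * ((u ⬝ᵥ u) * (v ⬝ᵥ v))) = 1 := by
    linear_combination (b ^ 2 * (v ⬝ᵥ v)) * ha + hb
  have orth : Matrix.of r * (Matrix.of r)ᵀ = 1 := by
    have key (i j : Fin 3) : r i ⬝ᵥ r j = (1 : Matrix (Fin 3) (Fin 3) ℝ) i j := by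
      fin_cases i <;> fin_cases j <;>
        simp [hr, huv, hvu, hcu, hcv, hcc, hab, dot_self_cross, dot_cross_self] <;>
        first | linear_combination ha | linear_combination hb
    ext i j
    exact key i j
  have hdet : (Matrix.of r).det = 1 := by
    have h := triple_product_eq_det (a • u) (b • v) ((a * b) • crossProduct u v)
    change _ = (Matrix.of r).det at h
    rw [← h, triple_product_permutation, triple_product_permutation]
    simp [hcc]
    linear_combination hab
  exact ⟨Matrix.of r, a, b, ⟨mul_eq_one_comm.mp orth, hdet⟩, rfl, rfl, by
    change ((a * b) • crossProduct u v) ⬝ᵥ u = 0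
    rw [smul_dotProduct, hcu, smul_zero]⟩

theorem mem_range_slice {R : Type*} [CommRing R] {u₁ u₂ : Fin 3 → R}
    {C : Matrix (Fin 3) (Fin 3) R} (h₁ : u₁ 1 = 0) (h₁' : u₁ 2 = 0) (h₂ : u₂ 1 = 0)
    (h₂' : u₂ 2 = 0) (hC : C 0 1 = 0) (hC' : C 1 0 = 0) :
    ∃ s, slice s = tripleCoords u₁ u₂ C := by
  refine ⟨![u₁ 0, u₂ 0, C 0 0, C 0 2, C 2 0, C 1 1, C 1 2, C 2 1, C 2 2], ?_⟩
  rw [slice]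
  congr 1
  · rw [← eta_vec u₁, h₁, h₁']; rfl
  · rw [← eta_vec u₂, h₂, h₂']; rfl
  · conv_rhs => rw [eta_fin_three C, hC, hC']
    rfl

theorem exists_coordAct_slice (x : Fin 15 → ℝ) (h₃ : coordInvariants x 2 ≠ 0)
    (h₄ : coordInvariants x 3 ≠ 0) :
    ∃ g₁ g₂ : Matrix (Fin 3) (Fin 3) ℝ, SO3R g₁ ∧ SO3R g₂ ∧
      ∃ s, coordAct g₁ g₂ (slice s) = x := by
  suffices h : ∃ g₁ g₂ : Matrix (Fin 3) (Fin 3) ℝ, SO3R g₁ ∧ SO3R g₂ ∧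
      ∃ s, slice s = coordAct g₁ g₂ x by
    obtain ⟨g₁, g₂, hg₁, hg₂, s, hs⟩ := h
    exact ⟨g₁ᵀ, g₂ᵀ, hg₁.transpose, hg₂.transpose, s, by
      rw [hs, coordAct_coordAct, hg₁.1, hg₂.1, coordAct_one]⟩
  unfold coordInvariants at h₃ h₄
  unfold coordAct
  generalize coordFst x = u₁, coordSnd x = u₂, coordMatrix x = C at *
  change crossProduct u₁ (C *ᵥ u₂) ⬝ᵥ crossProduct u₁ (C *ᵥ u₂) ≠ 0 at h₃
  change crossProduct u₂ (Cᵀ *ᵥ u₁) ⬝ᵥ crossProduct u₂ (Cᵀ *ᵥ u₁) ≠ 0 at h₄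
  have n₁ : u₁ ⬝ᵥ u₁ ≠ 0 := fun h => h₃ (by
    rw [dotProduct_self_eq_zero] at h; rw [h]; simp)
  have n₂ : u₂ ⬝ᵥ u₂ ≠ 0 := fun h => h₄ (by
    rw [dotProduct_self_eq_zero] at h; rw [h]; simp)
  obtain ⟨g₁, a₁, b₁, hg₁, r₁, s₁, t₁⟩ := exists_SO3R_rows n₁ h₃ (dot_self_cross _ _)
  obtain ⟨g₂, a₂, b₂, hg₂, r₂, s₂, t₂⟩ := exists_SO3R_rows n₂ h₄ (dot_self_cross _ _)
  have entry (i j : Fin 3) : (g₁ * C * g₂ᵀ) i j = g₁.row i ⬝ᵥ (C *ᵥ g₂.row j) := by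
    rw [dotProduct_mulVec]
    rfl
  refine ⟨g₁, g₂, hg₁, hg₂, mem_range_slice ?_ t₁ ?_ t₂ ?_ ?_⟩
  · change g₁.row 1 ⬝ᵥ u₁ = 0
    rw [s₁, smul_dotProduct, dotProduct_comm, dot_self_cross, smul_zero]
  · change g₂.row 1 ⬝ᵥ u₂ = 0
    rw [s₂, smul_dotProduct, dotProduct_comm, dot_self_cross, smul_zero]
  · rw [entry, r₁, s₂, dotProduct_mulVec, ← mulVec_transpose, mulVec_smul, smul_dotProduct,
      dotProduct_smul, dot_cross_self, smul_zero, smul_zero]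
  · rw [entry, s₁, r₂, mulVec_smul, smul_dotProduct, dotProduct_smul, dotProduct_comm,
      dot_cross_self, smul_zero, smul_zero]

/-! ### Algebraic independence -/

theorem exists_coordInvariants_slice_eq (z : Fin 9 → ℝ) (hz : ∀ i, 0 < z i) :
    ∃ s, coordInvariants (slice s) = z := by
  obtain ⟨r, hr, hrz⟩ : ∃ r : Fin 9 → ℝ, (∀ i, r i ≠ 0) ∧ ∀ i, r i ^ 2 = z i :=
    ⟨fun i => √(z i), fun i => (Real.sqrt_pos.2 (hz i)).ne', fun i => Real.sq_sqrt (hz i).le⟩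
  have := hr 0
  have := hr 1
  have := hr 2
  have := hr 3
  refine ⟨![r 0, r 1, z 4 / (r 0 * r 1), r 3 / (r 0 * r 1), r 2 / (r 0 * r 1),
    z 5 / (r 2 * r 3), z 7 / (r 1 * r 2 * r 3), z 8 / (r 0 * r 2 * r 3),
    z 6 / (r 0 * r 1 * r 2 * r 3)], ?_⟩
  rw [coordInvariants_slice]
  funext i
  fin_cases i <;> simp [← hrz] <;> field_simp

theorem algebraicIndependent_genFpolyR : AlgebraicIndependent ℝ genFpolyR := by
  rw [algebraicIndependent_iff]
  intro P hP
  refine MvPolynomial.funext_set (fun _ => Set.Ioi 0) (fun _ => Set.Ioi_infinite 0) ?_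
  intro z hz
  obtain ⟨s, hs⟩ := exists_coordInvariants_slice_eq z (fun i => hz i (Set.mem_univ i))
  rw [← hs, ← eval_aeval_genFpolyR, hP, map_zero, map_zero]

theorem eq_zero_of_eval_coordAct_slice {h : MvPolynomial (Fin 15) ℝ}
    (hh : ∀ g₁ g₂ : Matrix (Fin 3) (Fin 3) ℝ, SO3R g₁ → SO3R g₂ → ∀ s,
      eval (coordAct g₁ g₂ (slice s)) h = 0) : h = 0 := by
  have key : genFpolyR 2 * genFpolyR 3 * h = 0 := by
    refine MvPolynomial.funext fun x => ?_
    have hf (i) : eval x (genFpolyR i) = coordInvariants x i :=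
      congrFun (eval_comp_genFpolyR x) i
    rw [map_mul, map_mul, hf, hf, map_zero]
    by_cases h₃ : coordInvariants x 2 = 0
    · rw [h₃, zero_mul, zero_mul]
    by_cases h₄ : coordInvariants x 3 = 0
    · rw [h₄, mul_zero, zero_mul]
    obtain ⟨g₁, g₂, hg₁, hg₂, s, rfl⟩ := exists_coordAct_slice x h₃ h₄
    rw [hh g₁ g₂ hg₁ hg₂ s, mul_zero]
  have ne (i) := algebraicIndependent_genFpolyR.ne_zero i
  exact (mul_eq_zero.mp key).resolve_left (mul_ne_zero (ne 2) (ne 3))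

/-! ### Fields generated by square roots -/

section QuadraticDescent

open IntermediateField

variable {F K : Type*} [Field F] [Field K] [Algebra F K]

theorem exists_add_mul_of_mem_adjoin_insert {S : Set K} {t x : K} (ht : t ^ 2 ∈ adjoin F S)
    (hx : x ∈ adjoin F (insert t S)) :
    ∃ l ∈ adjoin F S, ∃ m ∈ adjoin F S, x = l + m * t := by
  induction hx using adjoin_induction with
  | mem x hx =>
    rcases hx with rfl | hx
    · exact ⟨0, zero_mem _, 1, one_mem _, by ring⟩
    · exact ⟨x, subset_adjoin F S hx, 0, zero_mem _, by ring⟩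
  | algebraMap r => exact ⟨_, IntermediateField.algebraMap_mem _ r, 0, zero_mem _, by ring⟩
  | add x y _ _ hx hy =>
    obtain ⟨l, hl, m, hm, rfl⟩ := hx
    obtain ⟨l', hl', m', hm', rfl⟩ := hy
    exact ⟨_, add_mem hl hl', _, add_mem hm hm', by ring⟩
  | mul x y _ _ hx hy =>
    obtain ⟨l, hl, m, hm, rfl⟩ := hx
    obtain ⟨l', hl', m', hm', rfl⟩ := hy
    exact ⟨_, add_mem (mul_mem hl hl') (mul_mem (mul_mem hm hm') ht), _,
      add_mem (mul_mem hl hm') (mul_mem hm hl'), by ring⟩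
  | inv x _ hx =>
    obtain ⟨l, hl, m, hm, rfl⟩ := hx
    by_cases hc : l - m * t = 0
    · have hmt : m * t = l := (sub_eq_zero.mp hc).symm
      exact ⟨_, inv_mem (add_mem hl hl), 0, zero_mem _, by rw [hmt]; ring⟩
    · have hN : l ^ 2 - m ^ 2 * t ^ 2 ∈ adjoin F S :=
        sub_mem (pow_mem hl 2) (mul_mem (pow_mem hm 2) ht)
      refine ⟨_, div_mem hl hN, _, div_mem (neg_mem hm) hN, ?_⟩
      rw [show l ^ 2 - m ^ 2 * t ^ 2 = (l + m * t) * (l - m * t) by ring]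
      by_cases hs : l + m * t = 0
      · simp [hs]
      · field_simp
        ring

theorem mem_adjoin_of_fixed {S : Set K} {t x : K} (τ : K →ₐ[F] K) (h2 : (2 : K) ≠ 0)
    (hS : ∀ s ∈ S, τ s = s) (hτ : τ t = -t) (ht : t ^ 2 ∈ adjoin F S)
    (hx : x ∈ adjoin F (insert t S)) (hfix : τ x = x) : x ∈ adjoin F S := by
  have fixed {l : K} (hl : l ∈ adjoin F S) : τ l = l := by
    induction hl using adjoin_induction with
    | mem x hx => exact hS x hx
    | algebraMap r => exact τ.commutes r
    | add x y _ _ hx hy => rw [map_add, hx, hy]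
    | mul x y _ _ hx hy => rw [map_mul, hx, hy]
    | inv x _ hx => rw [map_inv₀, hx]
  obtain ⟨l, hl, m, hm, rfl⟩ := exists_add_mul_of_mem_adjoin_insert ht hx
  rw [map_add, map_mul, fixed hl, fixed hm, hτ] at hfix
  have hmt : m * t = 0 := by
    have : 2 * (m * t) = 0 := by linear_combination -hfix
    exact (mul_eq_zero.mp this).resolve_left h2
  rwa [hmt, add_zero]

end QuadraticDescent

/-! ### Restriction to the slice and its sign symmetries -/

/-- Restriction of polynomials to the slice. -/
noncomputable def sliceHom : MvPolynomial (Fin 15) ℝ →ₐ[ℝ] MvPolynomial (Fin 9) ℝ :=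
  aeval (slice X)

theorem eval_sliceHom (s : Fin 9 → ℝ) (p : MvPolynomial (Fin 15) ℝ) :
    eval s (sliceHom p) = eval (slice s) p := by
  have hX : eval s ∘ X = s := by
    funext i
    simp
  rw [sliceHom, eval_aeval, comp_slice, hX]

/-- The action of a pair of diagonal matrices on the parameters of the slice. -/
def sliceScale (d e : Fin 3 → ℝ) : Fin 9 → ℝ :=
  ![d 0, e 0, d 0 * e 0, d 0 * e 2, d 2 * e 0, d 1 * e 1, d 1 * e 2, d 2 * e 1, d 2 * e 2]

theorem coordAct_diagonal_slice (d e : Fin 3 → ℝ) (s : Fin 9 → ℝ) :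
    coordAct (diagonal d) (diagonal e) (slice s) = slice (sliceScale d e * s) := by
  rw [coordAct, slice, coordFst_tripleCoords, coordSnd_tripleCoords, coordMatrix_tripleCoords,
    slice]
  congr 1
  · funext i
    fin_cases i <;> simp [mulVec_diagonal, sliceScale]
  · funext i
    fin_cases i <;> simp [mulVec_diagonal, sliceScale]
  · ext i j
    fin_cases i <;> fin_cases j <;>
      simp [sliceScale, diagonal_transpose, mul_diagonal, diagonal_mul] <;> ring

/-- Precomposition of polynomials on the slice with the action of a pair of diagonal matrices. -/
noncomputable def scaleHom (d e : Fin 3 → ℝ) :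
    MvPolynomial (Fin 9) ℝ →ₐ[ℝ] MvPolynomial (Fin 9) ℝ :=
  aeval fun i => C (sliceScale d e i) * X i

theorem eval_scaleHom (d e : Fin 3 → ℝ) (s : Fin 9 → ℝ) (h : MvPolynomial (Fin 9) ℝ) :
    eval s (scaleHom d e h) = eval (sliceScale d e * s) h := by
  rw [scaleHom, eval_aeval]
  congr 2
  funext i
  simp

theorem eval_scaleHom_sliceHom (d e : Fin 3 → ℝ) (s : Fin 9 → ℝ) (p : MvPolynomial (Fin 15) ℝ) :
    eval s (scaleHom d e (sliceHom p)) =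
      eval (coordAct (diagonal d) (diagonal e) (slice s)) p := by
  rw [eval_scaleHom, eval_sliceHom, coordAct_diagonal_slice]

theorem SO3R.diagonal_sq {d : Fin 3 → ℝ} (hd : SO3R (diagonal d)) (i : Fin 3) :
    d i * d i = 1 := by
  have h := hd.1
  rw [diagonal_transpose, diagonal_mul_diagonal, ← diagonal_one] at h
  exact congrFun (diagonal_injective h) i

theorem scaleHom_injective {d e : Fin 3 → ℝ} (hd : SO3R (diagonal d))
    (he : SO3R (diagonal e)) : Function.Injective (scaleHom d e) := by
  have hsq (i : Fin 9) : sliceScale d e i * sliceScale d e i = 1 := by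
    have hd := hd.diagonal_sq
    have he := he.diagonal_sq
    have hde (i j : Fin 3) : d i * e j * (d i * e j) = 1 := by
      rw [mul_mul_mul_comm, hd, he, one_mul]
    fin_cases i <;> first | exact hd _ | exact he _ | exact hde _ _
  refine Function.LeftInverse.injective (g := scaleHom d e) fun h => ?_
  refine MvPolynomial.funext fun s => ?_
  rw [eval_scaleHom, eval_scaleHom, ← mul_assoc]
  congr 2
  funext i
  simp [hsq]

theorem algHom_comp_scaleHom_injective {d e : Fin 3 → ℝ} (hd : SO3R (diagonal d))
    (he : SO3R (diagonal e)) :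
    Function.Injective ((Algebra.algHom ℝ (MvPolynomial (Fin 9) ℝ)
      (FractionRing (MvPolynomial (Fin 9) ℝ))).comp (scaleHom d e)) :=
  (IsFractionRing.injective _ _).comp (scaleHom_injective hd he)

/-- The automorphism of the function field of the slice given by a pair of diagonal rotations. -/
noncomputable def scaleFieldHom {d e : Fin 3 → ℝ} (hd : SO3R (diagonal d))
    (he : SO3R (diagonal e)) :
    FractionRing (MvPolynomial (Fin 9) ℝ) →ₐ[ℝ] FractionRing (MvPolynomial (Fin 9) ℝ) :=
  IsFractionRing.liftAlgHom (algHom_comp_scaleHom_injective hd he)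

theorem scaleFieldHom_algebraMap {d e : Fin 3 → ℝ} (hd : SO3R (diagonal d))
    (he : SO3R (diagonal e)) (h : MvPolynomial (Fin 9) ℝ) :
    scaleFieldHom hd he (algebraMap _ _ h) = algebraMap _ _ (scaleHom d e h) := by
  rw [scaleFieldHom, IsFractionRing.liftAlgHom_apply, IsFractionRing.lift_algebraMap]
  rfl

/-- The restrictions of the nine invariants to the slice. -/
noncomputable def sliceInvariants (i : Fin 9) : MvPolynomial (Fin 9) ℝ :=
  sliceHom (genFpolyR i)

theorem sliceInvariants_eq : sliceInvariants = coordInvariants (slice X) := by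
  change sliceHom.toRingHom ∘ genFpolyR = _
  rw [genFpolyR_eq_coordInvariants, comp_coordInvariants]
  congr 1
  funext i
  simp [sliceHom]

theorem scaleHom_sliceInvariants {d e : Fin 3 → ℝ} (hd : SO3R (diagonal d))
    (he : SO3R (diagonal e)) (i : Fin 9) :
    scaleHom d e (sliceInvariants i) = sliceInvariants i := by
  have hf (x) : eval x (genFpolyR i) = coordInvariants x i := congrFun (eval_comp_genFpolyR x) i
  refine MvPolynomial.funext fun s => ?_
  rw [sliceInvariants, eval_scaleHom_sliceHom, eval_sliceHom, hf, hf,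
    coordInvariants_coordAct hd he]

theorem SO3R_diagonal_first : SO3R (diagonal ![-1, 1, -1]) := by
  constructor
  · ext i j; fin_cases i <;> fin_cases j <;> simp
  · simp [det_diagonal, Fin.prod_univ_three]

theorem SO3R_diagonal_second : SO3R (diagonal ![1, -1, -1]) := by
  constructor
  · ext i j; fin_cases i <;> fin_cases j <;> simp
  · simp [det_diagonal, Fin.prod_univ_three]

theorem SO3R_diagonal_one : SO3R (diagonal 1) := by
  rw [diagonal_one']
  exact SO3R.one

section FunctionField

open IntermediateField

local notation "𝕂" => FractionRing (MvPolynomial (Fin 9) ℝ)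

/-- The lengths of `u₁`, `u₂`, `v₁`, `v₂` on the slice, up to sign. -/
noncomputable def sliceLength : Fin 4 → MvPolynomial (Fin 9) ℝ :=
  ![X 0, X 1, X 0 * X 1 * X 4, X 0 * X 1 * X 3]

theorem sliceLength_sq (i : Fin 4) :
    sliceLength i ^ 2 = sliceInvariants (Fin.castLE (by norm_num) i) := by
  rw [sliceInvariants_eq, coordInvariants_slice]
  fin_cases i <;> rfl

theorem adjoin_sliceLength_eq_top {L : IntermediateField ℝ 𝕂}
    (hf : ∀ i, algebraMap _ 𝕂 (sliceInvariants i) ∈ L)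
    (hl : ∀ i, algebraMap _ 𝕂 (sliceLength i) ∈ L) : L = ⊤ := by
  set ι := algebraMap (MvPolynomial (Fin 9) ℝ) 𝕂
  have hX (i : Fin 9) : ι (X i) ≠ 0 := fun h =>
    X_ne_zero i ((IsFractionRing.injective (MvPolynomial (Fin 9) ℝ) 𝕂) (by rw [h, map_zero]))
  have cancel {f g h : MvPolynomial (Fin 9) ℝ} (hne : ι f ≠ 0)
      (hfL : ι f ∈ L) (hgL : ι g ∈ L) (e : g = f * h) :
      ι h ∈ L := by
    have : ι h = ι g / ι f := by
      rw [e, map_mul, mul_div_cancel_left₀ _ hne]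
    rw [this]
    exact div_mem hgL hfL
  rw [sliceInvariants_eq, coordInvariants_slice] at hf
  have h0 : ι (X 0) ∈ L := hl 0
  have h1 : ι (X 1) ∈ L := hl 1
  have h01 : ι (X 0 * X 1) ∈ L := by rw [map_mul]; exact mul_mem h0 h1
  have h01' : ι (X 0 * X 1) ≠ 0 := by rw [map_mul]; exact mul_ne_zero (hX 0) (hX 1)
  have h2 : ι (X 2) ∈ L := cancel h01' h01 (hf 4) rfl
  have h3 : ι (X 3) ∈ L := cancel h01' h01 (hl 3) rfl
  have h4 : ι (X 4) ∈ L := cancel h01' h01 (hl 2) rfl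
  have mon (m n : ℕ) : ι (X 0 ^ m * X 1 ^ n * X 3 * X 4) ∈ L ∧
      ι (X 0 ^ m * X 1 ^ n * X 3 * X 4) ≠ 0 := by
    simp only [map_mul, map_pow]
    exact ⟨mul_mem (mul_mem (mul_mem (pow_mem h0 m) (pow_mem h1 n)) h3) h4,
      by simp [hX]⟩
  have h5 : ι (X 5) ∈ L := cancel (mon 2 2).2 (mon 2 2).1 (hf 5) rfl
  have h8 : ι (X 8) ∈ L := cancel (mon 3 3).2 (mon 3 3).1 (hf 6) rfl
  have h6 : ι (X 6) ∈ L := cancel (mon 2 3).2 (mon 2 3).1 (hf 7) rfl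
  have h7 : ι (X 7) ∈ L := cancel (mon 3 2).2 (mon 3 2).1 (hf 8) rfl
  have hpoly (h : MvPolynomial (Fin 9) ℝ) : ι h ∈ L := by
    induction h using MvPolynomial.induction_on with
    | C r =>
      rw [← MvPolynomial.algebraMap_eq, ← IsScalarTower.algebraMap_apply]
      exact IntermediateField.algebraMap_mem L r
    | add p q hp hq => rw [map_add]; exact add_mem hp hq
    | mul_X p i hp =>
      rw [map_mul]
      refine mul_mem hp ?_
      fin_cases i <;> assumption
  refine eq_top_iff.mpr fun x _ => ?_
  obtain ⟨n, m, -, rfl⟩ := IsFractionRing.div_surjective (A := MvPolynomial (Fin 9) ℝ) x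
  exact div_mem (hpoly n) (hpoly m)

theorem mem_adjoin_sliceInvariants {x : 𝕂}
    (hx : ∀ (d e : Fin 3 → ℝ) (hd : SO3R (diagonal d)) (he : SO3R (diagonal e)),
      scaleFieldHom hd he x = x) :
    x ∈ adjoin ℝ (Set.range fun i => algebraMap _ 𝕂 (sliceInvariants i)) := by
  set S := Set.range fun i => algebraMap _ 𝕂 (sliceInvariants i) with hS
  set l : Fin 4 → 𝕂 := fun i => algebraMap _ 𝕂 (sliceLength i) with hl
  have hS' {d e : Fin 3 → ℝ} (hd : SO3R (diagonal d)) (he : SO3R (diagonal e)) :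
      ∀ s ∈ S, scaleFieldHom hd he s = s := by
    rintro _ ⟨i, rfl⟩
    rw [scaleFieldHom_algebraMap, scaleHom_sliceInvariants hd he]
  have hsq (i : Fin 4) (T : Set 𝕂) (hT : S ⊆ T) : l i ^ 2 ∈ adjoin ℝ T := by
    refine subset_adjoin ℝ T (hT ⟨Fin.castLE (by norm_num) i, ?_⟩)
    rw [hl, ← map_pow, sliceLength_sq]
  have key {d e : Fin 3 → ℝ} (hd : SO3R (diagonal d)) (he : SO3R (diagonal e)) {i : Fin 4}
      {T : Set 𝕂} (hST : S ⊆ T) (hT : ∀ s ∈ T, scaleFieldHom hd he s = s)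
      (hi : scaleHom d e (sliceLength i) = -sliceLength i)
      (hxT : x ∈ adjoin ℝ (insert (l i) T)) : x ∈ adjoin ℝ T := by
    refine mem_adjoin_of_fixed (scaleFieldHom hd he) two_ne_zero hT ?_ (hsq i T hST) hxT
      (hx d e hd he)
    rw [hl, scaleFieldHom_algebraMap, hi, map_neg]
  have fix {d e : Fin 3 → ℝ} (hd : SO3R (diagonal d)) (he : SO3R (diagonal e)) {i : Fin 4}
      {T : Set 𝕂} (hT : ∀ s ∈ T, scaleFieldHom hd he s = s)
      (hi : scaleHom d e (sliceLength i) = sliceLength i) :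
      ∀ s ∈ insert (l i) T, scaleFieldHom hd he s = s := by
    rintro _ (rfl | hs)
    · rw [hl, scaleFieldHom_algebraMap, hi]
    · exact hT _ hs
  have step₀ : x ∈ adjoin ℝ (insert (l 0) (insert (l 1) (insert (l 2) (insert (l 3) S)))) := by
    have : adjoin ℝ (insert (l 0) (insert (l 1) (insert (l 2) (insert (l 3) S)))) = ⊤ := by
      refine adjoin_sliceLength_eq_top (fun i => subset_adjoin _ _ ?_)
        (fun i => subset_adjoin _ _ ?_)
      · simp only [Set.mem_insert_iff]
        exact Or.inr (Or.inr (Or.inr (Or.inr ⟨i, rfl⟩)))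
      · fin_cases i <;> simp [hl]
    rw [this]
    trivial
  have sub (t : 𝕂) {T : Set 𝕂} (hT : S ⊆ T) : S ⊆ insert t T :=
    hT.trans (Set.subset_insert t T)
  have step₁ : x ∈ adjoin ℝ (insert (l 1) (insert (l 2) (insert (l 3) S))) := by
    refine key SO3R_diagonal_first SO3R_diagonal_one (sub _ (sub _ (sub _ subset_rfl)))
      (fix _ _ (fix _ _ (fix _ _ (hS' _ _) ?_) ?_) ?_) ?_ step₀ <;>
    simp [scaleHom, sliceLength, sliceScale]
  have step₂ : x ∈ adjoin ℝ (insert (l 2) (insert (l 3) S)) := by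
    refine key SO3R_diagonal_one SO3R_diagonal_first (sub _ (sub _ subset_rfl))
      (fix _ _ (fix _ _ (hS' _ _) ?_) ?_) ?_ step₁ <;>
    simp [scaleHom, sliceLength, sliceScale]
  have step₃ : x ∈ adjoin ℝ (insert (l 3) S) := by
    refine key SO3R_diagonal_second SO3R_diagonal_one (sub _ subset_rfl)
      (fix _ _ (hS' _ _) ?_) ?_ step₂ <;>
    simp [scaleHom, sliceLength, sliceScale]
  refine key SO3R_diagonal_one SO3R_diagonal_second subset_rfl (hS' _ _) ?_ step₃
  simp [scaleHom, sliceLength, sliceScale]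

end FunctionField

/-! ### Invariant rational functions -/

theorem exists_mul_aeval_eq_of_sliceHom_ne_zero {p q : MvPolynomial (Fin 15) ℝ}
    (hq : sliceHom q ≠ 0)
    (hinv : ∀ g₁ g₂ : Matrix (Fin 3) (Fin 3) ℝ, SO3R g₁ → SO3R g₂ → ∀ x : Fin 15 → ℝ,
      eval (coordAct g₁ g₂ x) p * eval x q = eval x p * eval (coordAct g₁ g₂ x) q) :
    ∃ P Q : MvPolynomial (Fin 9) ℝ, aeval genFpolyR Q ≠ 0 ∧
      p * aeval genFpolyR Q = aeval genFpolyR P * q := by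
  let ι := algebraMap (MvPolynomial (Fin 9) ℝ) (FractionRing (MvPolynomial (Fin 9) ℝ))
  have hι : Function.Injective ι := IsFractionRing.injective _ _
  have hιq : ι (sliceHom q) ≠ 0 := fun h => hq (hι (by rw [h, map_zero]))
  obtain ⟨P, Q, hQ, hPQ⟩ : ∃ P Q : MvPolynomial (Fin 9) ℝ, sliceHom (aeval genFpolyR Q) ≠ 0 ∧
      sliceHom (p * aeval genFpolyR Q) = sliceHom (aeval genFpolyR P * q) := by
    have hmem := mem_adjoin_sliceInvariants (x := ι (sliceHom p) / ι (sliceHom q)) (by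
      intro d e hd he
      have hne : ι (scaleHom d e (sliceHom q)) ≠ 0 := fun h =>
        hq (scaleHom_injective hd he (hι (by rw [h, map_zero, map_zero])))
      rw [map_div₀, scaleFieldHom_algebraMap, scaleFieldHom_algebraMap, div_eq_div_iff hne hιq,
        ← map_mul, ← map_mul]
      congr 1
      refine MvPolynomial.funext fun s => ?_
      rw [map_mul, map_mul, eval_scaleHom_sliceHom, eval_scaleHom_sliceHom, eval_sliceHom,
        eval_sliceHom]
      exact hinv _ _ hd he _)
    obtain ⟨P, Q, h⟩ := (IntermediateField.mem_adjoin_range_iff ℝ _ _).mp hmem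
    have hcomp (A : MvPolynomial (Fin 9) ℝ) :
        aeval (fun i => ι (sliceInvariants i)) A = ι (sliceHom (aeval genFpolyR A)) := by
      induction A using MvPolynomial.induction_on with
      | C r =>
        rw [aeval_C, aeval_C, AlgHom.commutes]
        exact IsScalarTower.algebraMap_apply ℝ (MvPolynomial (Fin 9) ℝ) _ r
      | add A B hA hB => simp only [map_add, hA, hB]
      | mul_X A i hA =>
        rw [map_mul, map_mul, map_mul, map_mul, hA, aeval_X, aeval_X, sliceInvariants]
    rw [hcomp, hcomp] at h
    by_cases hQ : sliceHom (aeval genFpolyR Q) = 0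
    · rw [hQ, map_zero, div_zero, div_eq_zero_iff, or_iff_left hιq] at h
      have hp : sliceHom p = 0 := hι (by rw [h, map_zero])
      exact ⟨0, 1, by simp, by simp [hp]⟩
    · have hιQ : ι (sliceHom (aeval genFpolyR Q)) ≠ 0 := fun h => hQ (hι (by rw [h, map_zero]))
      rw [div_eq_div_iff hιq hιQ, ← map_mul, ← map_mul, ← map_mul, ← map_mul] at h
      exact ⟨P, Q, hQ, hι h⟩
  refine ⟨P, Q, fun h => hQ (by rw [h, map_zero]), ?_⟩
  rw [← sub_eq_zero]
  refine eq_zero_of_eval_coordAct_slice fun g₁ g₂ h₁ h₂ s => ?_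
  set h := p * aeval genFpolyR Q - aeval genFpolyR P * q with hh
  have key : sliceHom (actHom g₁ g₂ h) * sliceHom q = 0 := by
    refine MvPolynomial.funext fun s => ?_
    have h0 : eval (slice s) h = 0 := by
      rw [← eval_sliceHom, hh, map_sub, hPQ, sub_self, map_zero]
    rw [hh, map_sub, map_mul, map_mul] at h0
    rw [map_mul, eval_sliceHom, eval_sliceHom, eval_actHom, hh, map_sub, map_mul, map_mul,
      map_zero]
    simp only [eval_aeval_genFpolyR, coordInvariants_coordAct h₁ h₂] at h0 ⊢
    linear_combination eval (coordInvariants (slice s)) Q * hinv g₁ g₂ h₁ h₂ (slice s) +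
      eval (coordAct g₁ g₂ (slice s)) q * h0
  have hzero := (mul_eq_zero.mp key).resolve_right hq
  rw [← eval_actHom, ← eval_sliceHom, hzero, map_zero]

theorem exists_mul_aeval_eq_of_invariant {p q : MvPolynomial (Fin 15) ℝ} (hq : q ≠ 0)
    (hinv : ∀ g₁ g₂ : Matrix (Fin 3) (Fin 3) ℝ, SO3R g₁ → SO3R g₂ → ∀ x : Fin 15 → ℝ,
      eval (coordAct g₁ g₂ x) p * eval x q = eval x p * eval (coordAct g₁ g₂ x) q) :
    ∃ P Q : MvPolynomial (Fin 9) ℝ, aeval genFpolyR Q ≠ 0 ∧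
      p * aeval genFpolyR Q = aeval genFpolyR P * q := by
  obtain ⟨g₁, g₂, h₁, h₂, hne⟩ : ∃ g₁ g₂ : Matrix (Fin 3) (Fin 3) ℝ, SO3R g₁ ∧ SO3R g₂ ∧
      sliceHom (actHom g₁ g₂ q) ≠ 0 := by
    by_contra! hall
    refine hq (eq_zero_of_eval_coordAct_slice fun g₁ g₂ h₁ h₂ s => ?_)
    rw [← eval_actHom, ← eval_sliceHom, hall g₁ g₂ h₁ h₂, map_zero]
  obtain ⟨P, Q, hQ, hPQ⟩ := exists_mul_aeval_eq_of_sliceHom_ne_zero (p := actHom g₁ g₂ p) hne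
    (by
      intro k₁ k₂ hk₁ hk₂ x
      have conj {g k : Matrix (Fin 3) (Fin 3) ℝ} (hg : SO3R g) : g * k * gᵀ * g = g * k := by
        rw [Matrix.mul_assoc, hg.1, Matrix.mul_one]
      have := hinv (g₁ * k₁ * g₁ᵀ) (g₂ * k₂ * g₂ᵀ) ((h₁.mul hk₁).mul h₁.transpose)
        ((h₂.mul hk₂).mul h₂.transpose) (coordAct g₁ g₂ x)
      rw [coordAct_coordAct, conj h₁, conj h₂] at this
      simpa only [eval_actHom, coordAct_coordAct] using this)
  have hrel : actHom g₁ g₂ p * q = p * actHom g₁ g₂ q := by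
    refine MvPolynomial.funext fun x => ?_
    rw [map_mul, map_mul, eval_actHom, eval_actHom]
    exact hinv g₁ g₂ h₁ h₂ x
  have hne' : actHom g₁ g₂ q ≠ 0 := fun h => hne (by rw [h, map_zero])
  refine ⟨P, Q, hQ, mul_right_cancel₀ hne' ?_⟩
  linear_combination q * hPQ - aeval genFpolyR Q * hrel

theorem invariant_of_mul_aeval_eq {p q : MvPolynomial (Fin 15) ℝ} {P Q : MvPolynomial (Fin 9) ℝ}
    (hQ : aeval genFpolyR Q ≠ 0) (hPQ : p * aeval genFpolyR Q = aeval genFpolyR P * q)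
    {g₁ g₂ : Matrix (Fin 3) (Fin 3) ℝ} (h₁ : SO3R g₁) (h₂ : SO3R g₂) (x : Fin 15 → ℝ) :
    eval (coordAct g₁ g₂ x) p * eval x q = eval x p * eval (coordAct g₁ g₂ x) q := by
  have key : actHom g₁ g₂ p * q = p * actHom g₁ g₂ q := by
    refine mul_right_cancel₀ hQ (MvPolynomial.funext fun y => ?_)
    have e₁ := congrArg (eval y) hPQ
    have e₂ := congrArg (eval (coordAct g₁ g₂ y)) hPQ
    simp only [map_mul, eval_aeval_genFpolyR, coordInvariants_coordAct h₁ h₂, eval_actHom]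
      at e₁ e₂ ⊢
    linear_combination eval y q * e₂ - eval (coordAct g₁ g₂ y) q * e₁
  have := congrArg (eval x) key
  rwa [map_mul, map_mul, eval_actHom, eval_actHom] at this

/-- The field of real-valued rational local unitary invariants of mixed states of two
qubits is purely transcendental over ℝ, equal to `ℝ(f₁, …, f₉)` with `f₁, …, f₉`
algebraically independent: a real rational function `p/q` is SO₃(ℝ)×SO₃(ℝ)-invariant
iff it is a rational function of `f₁, …, f₉`. -/
theorem real_invariant_field_rational :
    AlgebraicIndependent ℝ genFpolyR ∧
      ∀ p q : MvPolynomial (Fin 15) ℝ, q ≠ 0 →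
        ((∀ g₁ g₂ : Matrix (Fin 3) (Fin 3) ℝ, SO3R g₁ → SO3R g₂ → ∀ x : Fin 15 → ℝ,
            eval (genActR g₁ g₂ x) p * eval x q = eval x p * eval (genActR g₁ g₂ x) q) ↔
          ∃ P Q : MvPolynomial (Fin 9) ℝ, aeval genFpolyR Q ≠ 0 ∧
            p * aeval genFpolyR Q = aeval genFpolyR P * q) := by
  refine ⟨algebraicIndependent_genFpolyR, fun p q hq => ?_⟩
  simp only [genActR_eq_coordAct]
  exact ⟨exists_mul_aeval_eq_of_invariant hq, fun ⟨P, Q, hQ, hPQ⟩ g₁ g₂ h₁ h₂ x =>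
    invariant_of_mul_aeval_eq hQ hPQ h₁ h₂ x⟩
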